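/- Let f: ℝⁿ → ℝ be continuously differentiable, λ > 0, τ > 0, and x ∈ ℝⁿ. Define T = { i : |x_i − τ∇_i f(x)| ≥ √(2τλ) }. If ∇_i f(x) = 0 for all i ∈ T and x_i = 0 for all i ∉ T, then x ∈ Prox_{τλ‖·‖₀}(x − τ∇f(x)); that is, x is a τ-stationary point of min_{x∈ℝⁿ} f(x) + λ‖x‖₀. -/

import Mathlib

open scoped RealInnerProductSpace

/-- The ℓ₀ "norm": number of nonzero entries of `x`. -/
noncomputable def norm0 {n : ℕ} (x : EuclideanSpace ℝ (Fin n)) : ℕ :=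
  (Finset.univ.filter fun i => x i ≠ 0).card

/-- `proxL0 c z` is the set of minimizers of `z' ↦ (1/2)‖z' - z‖² + c ‖z'‖₀`. -/
def proxL0 {n : ℕ} (c : ℝ) (z : EuclideanSpace ℝ (Fin n)) :
    Set (EuclideanSpace ℝ (Fin n)) :=
  {w | ∀ u : EuclideanSpace ℝ (Fin n),
    (1:ℝ)/2 * ‖w - z‖^2 + c * (norm0 w : ℝ) ≤ (1:ℝ)/2 * ‖u - z‖^2 + c * (norm0 u : ℝ)}

/-- `x` is a `τ`-stationary point of `min f(x) + λ‖x‖₀`. -/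
def IsTauStationary {n : ℕ} (f : EuclideanSpace ℝ (Fin n) → ℝ) (lam τ : ℝ)
    (x : EuclideanSpace ℝ (Fin n)) : Prop :=
  x ∈ proxL0 (τ * lam) (x - τ • gradient f x)

theorem proxL0_objective_eq_sum {n : ℕ} (c : ℝ) (u z : EuclideanSpace ℝ (Fin n)) :
    (1:ℝ)/2 * ‖u - z‖^2 + c * (norm0 u : ℝ) =
      ∑ i, ((1:ℝ)/2 * (u i - z i)^2 + c * (if u i ≠ 0 then 1 else 0)) := by
  rw [EuclideanSpace.real_norm_sq_eq, norm0, Finset.card_filter, Finset.sum_add_distrib,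
    ← Finset.mul_sum, ← Finset.mul_sum]
  push_cast
  rfl

/-- Hard thresholding in one variable, written in terms of the point `a` and the step `d`. -/
theorem scalar_prox_le {c a d : ℝ} (hc : 0 < c)
    (hlarge : √(2 * c) ≤ |a - d| → d = 0) (hsmall : |a - d| < √(2 * c) → a = 0) (b : ℝ) :
    (1:ℝ)/2 * (a - (a - d))^2 + c * (if a ≠ 0 then 1 else 0) ≤
      (1:ℝ)/2 * (b - (a - d))^2 + c * (if b ≠ 0 then 1 else 0) := by
  rcases le_or_gt (√(2 * c)) |a - d| with h | h
  · obtain rfl := hlarge h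
    have hsq : 2 * c ≤ (a - 0)^2 := by
      rw [← sq_abs]
      exact (Real.sqrt_le_left (abs_nonneg _)).1 h
    split_ifs <;> simp_all <;> nlinarith [sq_nonneg (b - a)]
  · obtain rfl := hsmall h
    have hsq : (0 - d)^2 < 2 * c := by
      rw [← sq_abs]
      exact (Real.lt_sqrt (abs_nonneg _)).1 h
    by_cases hb : b = 0
    · simp [hb]
    · simp only [ne_eq, not_true_eq_false, if_false, hb, not_false_eq_true, if_true]
      nlinarith [sq_nonneg (b - (0 - d))]

/-- if the stationary equation `F_τ(x;T) = 0` holds, then `x` is a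
τ-stationary point (second implication of Theorem 2.2). -/
theorem stationary_equation_implies_tau_stationary {n : ℕ}
    (f : EuclideanSpace ℝ (Fin n) → ℝ) (hf : ContDiff ℝ 1 f)
    (lam τ : ℝ) (hlam : 0 < lam) (hτ : 0 < τ)
    (x : EuclideanSpace ℝ (Fin n))
    (hgrad : ∀ i : Fin n,
      Real.sqrt (2 * τ * lam) ≤ |x i - τ * gradient f x i| → gradient f x i = 0)
    (hzero : ∀ i : Fin n,
      |x i - τ * gradient f x i| < Real.sqrt (2 * τ * lam) → x i = 0) :
    IsTauStationary f lam τ x := by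
  intro u
  rw [proxL0_objective_eq_sum, proxL0_objective_eq_sum]
  refine Finset.sum_le_sum fun i _ => ?_
  rw [mul_assoc] at hgrad hzero
  simpa using scalar_prox_le (mul_pos hτ hlam) (d := τ * gradient f x i)
    (fun h => by rw [hgrad i h, mul_zero]) (hzero i) (u i)
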